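/- Let g(x₀,x₁,x₃) = x₀x₁ + a₀(x₀ - a₇x₃)x₃² + a₁(x₁ - a₅x₃)x₃² + (x₀ - a₇x₃)³ + (x₁ - a₅x₃)³ - t x₃³, and set γ = -a₀a₇ - a₁a₅ - a₇³ - a₅³. If t ≠ γ then g has a singularity of type A₂ at the origin, i.e., g is right-equivalent to x² + y² + z³. -/

import Mathlib

open Filter

/-- The local equation at infinity after the coordinate change, in variables
`v = (x₀, x₁, x₃)`. -/
def gA2 (a0 a1 a5 a7 t : ℂ) (v : Fin 3 → ℂ) : ℂ :=
  v 0 * v 1 + a0 * (v 0 - a7 * v 2) * v 2 ^ 2 + a1 * (v 1 - a5 * v 2) * v 2 ^ 2 +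
    (v 0 - a7 * v 2) ^ 3 + (v 1 - a5 * v 2) ^ 3 - t * v 2 ^ 3

section

open scoped Matrix

/-- A map of the form `v ↦ M v *ᵥ v`, with `M` an analytic matrix-valued function, has derivative
`M 0` at the origin. -/
lemma hasFDerivAt_mulVec_self_zero {𝕜 ι : Type*} [RCLike 𝕜] [Fintype ι] [DecidableEq ι]
    {M : (ι → 𝕜) → Matrix ι ι 𝕜} (hM : ∀ i j, AnalyticAt 𝕜 (fun v => M v i j) 0) :
    HasFDerivAt (fun v => M v *ᵥ v) (Matrix.toLin' (M 0)).toContinuousLinearMap 0 := by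
  rw [hasFDerivAt_pi']
  intro i
  have h := HasFDerivAt.fun_sum (u := Finset.univ) fun j _ =>
    (hM i j).differentiableAt.hasFDerivAt.mul
      (ContinuousLinearMap.proj (R := 𝕜) (φ := fun _ : ι => 𝕜) j).hasFDerivAt
  refine h.congr_fderiv ?_
  ext v
  simp [Matrix.mulVec, dotProduct]

/-- The inverse function theorem for a map `v ↦ M v *ᵥ v` with `M` analytic and `M 0` invertible. -/
lemma exists_analytic_local_inverse_mulVec_self {𝕜 ι : Type*} [RCLike 𝕜] [Fintype ι]
    [DecidableEq ι] {M : (ι → 𝕜) → Matrix ι ι 𝕜}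
    (hM : ∀ i j, AnalyticAt 𝕜 (fun v => M v i j) 0) (hdet : (M 0).det ≠ 0) :
    AnalyticAt 𝕜 (fun v => M v *ᵥ v) 0 ∧
    ∃ φ : (ι → 𝕜) → (ι → 𝕜), φ 0 = 0 ∧ AnalyticAt 𝕜 φ 0 ∧
      (∀ᶠ v in nhds 0, M (φ v) *ᵥ φ v = v) ∧ (∀ᶠ v in nhds 0, φ (M v *ᵥ v) = v) := by
  have hψ : AnalyticAt 𝕜 (fun v => M v *ᵥ v) 0 := by
    rw [analyticAt_pi_iff]
    intro i
    exact Finset.analyticAt_fun_sum _ fun j _ => (hM i j).mul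
      ((ContinuousLinearMap.proj (R := 𝕜) (φ := fun _ : ι => 𝕜) j).analyticAt 0)
  have hψ' : ContDiffAt 𝕜 ⊤ (fun v => M v *ᵥ v) 0 := hψ.contDiffAt
  let e : (ι → 𝕜) ≃L[𝕜] (ι → 𝕜) := (LinearEquiv.ofIsUnitDet
    (f := Matrix.toLin' (M 0)) (v := Pi.basisFun 𝕜 ι) (v' := Pi.basisFun 𝕜 ι)
    (by simpa [LinearMap.toMatrix_eq_toMatrix'] using hdet)).toContinuousLinearEquiv
  have hd : HasFDerivAt (fun v => M v *ᵥ v) (e : (ι → 𝕜) →L[𝕜] (ι → 𝕜)) 0 :=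
    (hasFDerivAt_mulVec_self_zero hM).congr_fderiv (by ext; rfl)
  have h0 : M 0 *ᵥ (0 : ι → 𝕜) = 0 := Matrix.mulVec_zero _
  have hstrict := hψ'.hasStrictFDerivAt' hd (by simp)
  refine ⟨hψ, hψ'.localInverse hd (by simp), ?_, ?_, ?_, ?_⟩
  · simpa only [h0] using hψ'.localInverse_apply_image hd (by simp)
  · have := hψ'.to_localInverse hd (by simp)
    rw [h0] at this
    exact this.analyticAt
  · have := hstrict.eventually_right_inverse
    rw [h0] at this
    exact this
  · exact hstrict.eventually_left_inverse

end

/-- Splitting the quadratic form `P x² + x y + Q y²` into linear factors and completing the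
product. -/
lemma completed_product_identity {R : Type*} [CommRing R] {u w σ P Q A B c κ : R} (x y z : R)
    (huw : u * w = 1) (hu : u + P * Q * w = 1) (hσ : σ * (u - P * Q * w) = 1)
    (hκ : κ ^ 3 = c - z * (σ * (A - B * w * P)) * (σ * (B * u - A * Q))) :
    (u * x + Q * y + z ^ 2 * (σ * (B * u - A * Q))) *
        (w * P * x + y + z ^ 2 * (σ * (A - B * w * P))) + (κ * z) ^ 3 =
      P * x ^ 2 + x * y + Q * y ^ 2 + z ^ 2 * (A * x + B * y) + c * z ^ 3 := by
  linear_combination P * x ^ 2 * huw + x * y * hu + z ^ 2 * (A * x + B * y) * hσ + z ^ 3 * hκ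

/-- If `t ≠ γ = -a₀a₇ - a₁a₅ - a₇³ - a₅³`, then `g` has an `A₂` singularity at the
origin: it is right-equivalent to `x² + y² + z³` via a local biholomorphic change of
coordinates fixing `0`. -/
theorem gA2_is_A2 (a0 a1 a5 a7 t : ℂ)
    (ht : t ≠ -a0 * a7 - a1 * a5 - a7 ^ 3 - a5 ^ 3) :
    ∃ φ ψ : (Fin 3 → ℂ) → (Fin 3 → ℂ),
      φ 0 = 0 ∧ ψ 0 = 0 ∧
      AnalyticAt ℂ φ 0 ∧ AnalyticAt ℂ ψ 0 ∧
      (∀ᶠ v in nhds (0 : Fin 3 → ℂ), ψ (φ v) = v) ∧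
      (∀ᶠ v in nhds (0 : Fin 3 → ℂ), φ (ψ v) = v) ∧
      (∀ᶠ v in nhds (0 : Fin 3 → ℂ),
        gA2 a0 a1 a5 a7 t (φ v) = (v 0) ^ 2 + (v 1) ^ 2 + (v 2) ^ 3) := by
  obtain ⟨c, hc⟩ : ∃ c, c = -a0 * a7 - a1 * a5 - a7 ^ 3 - a5 ^ 3 - t := ⟨_, rfl⟩
  have hc0 : c ≠ 0 := hc ▸ sub_ne_zero.2 ht.symm
  obtain ⟨k, hk⟩ : ∃ k : ℂ, k ^ 3 = c := IsAlgClosed.exists_pow_nat_eq c (by norm_num)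
  have hk0 : k ≠ 0 := by rintro rfl; exact hc0 (by simpa using hk.symm)
  have hcoord : ∀ i : Fin 3, AnalyticAt ℂ (fun v : Fin 3 → ℂ => v i) 0 := fun i =>
    (ContinuousLinearMap.proj (R := ℂ) (φ := fun _ : Fin 3 => ℂ) i).analyticAt 0
  let z : (Fin 3 → ℂ) → ℂ := fun v => v 2
  have hz : AnalyticAt ℂ z 0 := hcoord 2
  let P : (Fin 3 → ℂ) → ℂ := fun v => v 0 - 3 * a7 * v 2
  let Q : (Fin 3 → ℂ) → ℂ := fun v => v 1 - 3 * a5 * v 2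
  let s : (Fin 3 → ℂ) → ℂ := fun v => (1 - 4 * P v * Q v) ^ (((2 : ℕ) : ℂ)⁻¹)
  let u : (Fin 3 → ℂ) → ℂ := fun v => (1 + s v) / 2
  let w : (Fin 3 → ℂ) → ℂ := fun v => (u v)⁻¹
  let σ : (Fin 3 → ℂ) → ℂ := fun v => (s v)⁻¹
  let A : ℂ := a0 + 3 * a7 ^ 2
  let B : ℂ := a1 + 3 * a5 ^ 2
  let A' : (Fin 3 → ℂ) → ℂ := fun v => σ v * (A - B * w v * P v)
  let B' : (Fin 3 → ℂ) → ℂ := fun v => σ v * (B * u v - A * Q v)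
  let κ : (Fin 3 → ℂ) → ℂ := fun v =>
    k * (1 - v 2 * A' v * B' v / c) ^ (((3 : ℕ) : ℂ)⁻¹)
  have hP0 : P 0 = 0 := by simp [P]
  have hQ0 : Q 0 = 0 := by simp [Q]
  have hs0 : s 0 = 1 := by simp [s, hP0]
  have hu0 : u 0 = 1 := by norm_num [u, hs0]
  have hw0 : w 0 = 1 := by simp [w, hu0]
  have hκ0 : κ 0 = k := by simp [κ]
  have hP : AnalyticAt ℂ P 0 := (hcoord 0).sub (analyticAt_const.mul (hcoord 2))
  have hQ : AnalyticAt ℂ Q 0 := (hcoord 1).sub (analyticAt_const.mul (hcoord 2))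
  have hs : AnalyticAt ℂ s 0 := by
    refine AnalyticAt.cpow (by fun_prop) analyticAt_const ?_
    simp [hP0]
  have hu : AnalyticAt ℂ u 0 := (analyticAt_const.add hs).div analyticAt_const two_ne_zero
  have hw : AnalyticAt ℂ w 0 := hu.inv (by simp [hu0])
  have hσ : AnalyticAt ℂ σ 0 := hs.inv (by simp [hs0])
  have hA' : AnalyticAt ℂ A' 0 := by fun_prop
  have hB' : AnalyticAt ℂ B' 0 := by fun_prop
  have hκ : AnalyticAt ℂ κ 0 := by
    refine analyticAt_const.mul (AnalyticAt.cpow ?_ analyticAt_const (by simp))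
    exact analyticAt_const.sub
      ((((hcoord 2).mul hA').mul hB').div analyticAt_const hc0)
  let M : (Fin 3 → ℂ) → Matrix (Fin 3) (Fin 3) ℂ := fun v =>
    !![(u v + w v * P v) / 2, (Q v + 1) / 2, z v * (B' v + A' v) / 2;
      Complex.I * (u v - w v * P v) / 2, Complex.I * (Q v - 1) / 2,
        Complex.I * (z v * (B' v - A' v)) / 2;
      0, 0, κ v]
  have hM : ∀ i j, AnalyticAt ℂ (fun v => M v i j) 0 := by
    intro i j
    fin_cases i <;> fin_cases j <;> simp [M, div_eq_mul_inv] <;> fun_prop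
  have hdet : (M 0).det ≠ 0 := by
    have : (M 0).det = -Complex.I * k / 2 := by
      simp [M, Matrix.det_fin_three, hP0, hQ0, hu0, hw0, hκ0]
      ring
    rw [this]
    simp [hk0]
  obtain ⟨hψ, φ, hφ0, hφ, hr, hl⟩ := exists_analytic_local_inverse_mulVec_self hM hdet
  refine ⟨φ, fun v => (M v).mulVec v, hφ0, Matrix.mulVec_zero _, hφ, hψ, hr, hl, ?_⟩
  have hg : ∀ᶠ v in nhds (0 : Fin 3 → ℂ), gA2 a0 a1 a5 a7 t v =
      (M v).mulVec v 0 ^ 2 + (M v).mulVec v 1 ^ 2 + (M v).mulVec v 2 ^ 3 := by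
    filter_upwards [hs.continuousAt.eventually_ne (hs0.trans_ne one_ne_zero),
      hu.continuousAt.eventually_ne (hu0.trans_ne one_ne_zero)] with v hsv huv
    have hs2 : s v ^ 2 = 1 - 4 * P v * Q v := Complex.cpow_nat_inv_pow _ two_ne_zero
    have huw : u v * w v = 1 := mul_inv_cancel₀ huv
    have hus : 2 * u v = 1 + s v := by simp only [u]; ring
    have hu1 : u v + P v * Q v * w v = 1 := by
      apply mul_left_cancel₀ huv
      linear_combination P v * Q v * huw + hs2 / 4 + (2 * u v - 1 + s v) / 4 * hus
    have hσ1 : σ v * (u v - P v * Q v * w v) = 1 := by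
      have : u v - P v * Q v * w v = s v := by linear_combination hus - hu1
      rw [this]
      exact inv_mul_cancel₀ hsv
    have hκ3 : κ v ^ 3 = c - v 2 * A' v * B' v := by
      simp only [κ, mul_pow, hk, Complex.cpow_nat_inv_pow _ three_ne_zero]
      field_simp
    have key : (u v * v 0 + Q v * v 1 + v 2 ^ 2 * B' v) *
        (w v * P v * v 0 + v 1 + v 2 ^ 2 * A' v) + (κ v * v 2) ^ 3 =
        P v * v 0 ^ 2 + v 0 * v 1 + Q v * v 1 ^ 2 + v 2 ^ 2 * (A * v 0 + B * v 1) +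
          c * v 2 ^ 3 :=
      completed_product_identity (v 0) (v 1) (v 2) huw hu1 hσ1 hκ3
    have h0 : (M v).mulVec v 0 = ((u v * v 0 + Q v * v 1 + v 2 ^ 2 * B' v) +
        (w v * P v * v 0 + v 1 + v 2 ^ 2 * A' v)) / 2 := by
      simp [M, z, Matrix.mulVec, dotProduct, Fin.sum_univ_three]
      ring
    have h1 : (M v).mulVec v 1 = Complex.I * ((u v * v 0 + Q v * v 1 + v 2 ^ 2 * B' v) -
        (w v * P v * v 0 + v 1 + v 2 ^ 2 * A' v)) / 2 := by
      simp [M, z, Matrix.mulVec, dotProduct, Fin.sum_univ_three]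
      ring
    have h2 : (M v).mulVec v 2 = κ v * v 2 := by
      simp [M, Matrix.mulVec, dotProduct, Fin.sum_univ_three]
    have hgv : gA2 a0 a1 a5 a7 t v = P v * v 0 ^ 2 + v 0 * v 1 + Q v * v 1 ^ 2 +
        v 2 ^ 2 * (A * v 0 + B * v 1) + c * v 2 ^ 3 := by
      simp only [gA2, P, Q, A, B, hc]
      ring
    rw [hgv, ← key, h0, h1, h2]
    linear_combination -((u v * v 0 + Q v * v 1 + v 2 ^ 2 * B' v) -
      (w v * P v * v 0 + v 1 + v 2 ^ 2 * A' v)) ^ 2 / 4 * Complex.I_sq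
  have hφt : Tendsto φ (nhds 0) (nhds 0) := by
    simpa only [ContinuousAt, hφ0] using hφ.continuousAt
  filter_upwards [hφt.eventually hg, hr] with v hv hrv
  rw [hv, hrv]
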